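/- Let v be a positive function of class C³ on an open set of ℝ^N and let V : ℝ^N → [0,∞) be of class C³ and such that V(Dv)·div(∇_ξV(Dv)) extends continuously by 0 at points where Dv = 0. Set W = ∇_ξ²V(Dv) D²v. Then for every γ ∈ ℝ the pointwise identity 2 v^γ S_2(W) = div( v^γ S²_{ij}(W) V_{ξ_i}(Dv) ) − γ v^{γ−1} S²_{ij}(W) V_{ξ_i}(Dv) ∂_j v holds (summation over repeated indices). -/

import Mathlib

open MeasureTheory Filter Set
open scoped Topology RealInnerProductSpace NNReal

noncomputable section

abbrev Euc (N : ℕ) := EuclideanSpace ℝ (Fin N)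

variable {N : ℕ}

/-- The partial derivative of `f` in the `i`-th coordinate direction. -/
def pd (i : Fin N) (f : Euc N → ℝ) (x : Euc N) : ℝ :=
  fderiv ℝ f x (EuclideanSpace.single i 1)

/-- The Hessian matrix of `f` at `x`. -/
def hessM (f : Euc N → ℝ) (x : Euc N) : Matrix (Fin N) (Fin N) ℝ :=
  Matrix.of fun i j => pd i (pd j f) x

/-- Interpret a plain function `Fin N → ℝ` as a point of Euclidean space. -/
def toEuc {N : ℕ} (f : Fin N → ℝ) : Euc N := (WithLp.equiv 2 (Fin N → ℝ)).symm f

/-- The divergence of a vector field. -/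
def divVF (X : Euc N → Euc N) (x : Euc N) : ℝ := ∑ i, pd i (fun y => X y i) x

/-- The quadratic form associated to a matrix. -/
def qForm (A : Matrix (Fin N) (Fin N) ℝ) (ζ : Euc N) : ℝ := ∑ i, ∑ j, A i j * ζ i * ζ j

/-- Local `α`-Hölder continuity of `g` on `s` (uniform on compact subsets). -/
def LocHolderOn {X Y : Type*} [NormedAddCommGroup X] [NormedAddCommGroup Y]
    (α : ℝ) (g : X → Y) (s : Set X) : Prop :=
  ∀ K : Set X, K ⊆ s → IsCompact K → ∃ C : ℝ, ∀ x ∈ K, ∀ y ∈ K, ‖g x - g y‖ ≤ C * ‖x - y‖ ^ α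

/-- The dual norm `H₀(x) = sup_{ξ ≠ 0} ⟨x, ξ⟩ / H(ξ)`. -/
def dualNorm (H : Euc N → ℝ) (x : Euc N) : ℝ :=
  ⨆ ξ : {ξ : Euc N // ξ ≠ 0}, ⟪x, (ξ : Euc N)⟫ / H ξ

/-- `V = H^p / p`. -/
def Vfun (H : Euc N → ℝ) (p : ℝ) : Euc N → ℝ := fun ξ => H ξ ^ p / p

/-- `H` is a norm of class `I_p`: a norm which is `C^{2,α}` away from the origin, for some
`α ∈ (0,1)`, such that `V = H^p/p` is `C²` away from the origin with Hessian having positive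
eigenvalues uniformly bounded away from `0` on the unit sphere. -/
structure IsIpNorm (p : ℝ) (H : Euc N → ℝ) : Prop where
  convex : ConvexOn ℝ Set.univ H
  homog : ∀ (t : ℝ) (ξ : Euc N), H (t • ξ) = |t| * H ξ
  pos : ∀ ξ : Euc N, ξ ≠ 0 → 0 < H ξ
  smooth : ContDiffOn ℝ 2 H {(0 : Euc N)}ᶜ
  holder : ∃ α ∈ Set.Ioo (0:ℝ) 1,
    LocHolderOn α (iteratedFDerivWithin ℝ 2 H {(0 : Euc N)}ᶜ) {(0 : Euc N)}ᶜ
  Vsmooth : ContDiffOn ℝ 2 (Vfun H p) {(0 : Euc N)}ᶜ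
  hessV_pos : ∃ c > 0, ∀ ξ : Euc N, ‖ξ‖ = 1 → ∀ ζ : Euc N,
    c * ‖ζ‖ ^ 2 ≤ qForm (hessM (Vfun H p) ξ) ζ

/-- `Ω` is, up to a translation, the Wulff shape `B_{H₀}(r)` of `H` for some `r > 0`. -/
def IsWulffShape (H : Euc N → ℝ) (Ω : Set (Euc N)) : Prop :=
  ∃ (x₀ : Euc N) (r : ℝ), 0 < r ∧ Ω = {x | dualNorm H (x - x₀) < r}

/-- An open set with boundary of class `C^{2,α}`, described by a `C^{2,α}` defining function. -/
def IsC2alphaDomain (Ω : Set (Euc N)) : Prop :=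
  IsOpen Ω ∧ ∃ f : Euc N → ℝ, ContDiff ℝ 2 f ∧
    (∃ α ∈ Set.Ioo (0:ℝ) 1, LocHolderOn α (iteratedFDeriv ℝ 2 f) (Set.univ : Set (Euc N))) ∧
    Ω = {x | f x < 0} ∧ frontier Ω = {x | f x = 0} ∧
    ∀ x ∈ frontier Ω, gradient f x ≠ 0

/-- Weak solution of `Δ_p^H u = -1` in `Ω`, `u = 0` on `∂Ω`. -/
structure IsInteriorSol (H : Euc N → ℝ) (p : ℝ) (Ω : Set (Euc N)) (u : Euc N → ℝ) : Prop where
  contOn : ContinuousOn u (closure Ω)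
  diff : ∀ x ∈ Ω, DifferentiableAt ℝ u x
  bdry : ∀ x ∈ frontier Ω, u x = 0
  int_u : IntegrableOn u Ω
  int_grad : IntegrableOn (fun x => H (gradient u x) ^ p) Ω
  weak : ∀ φ : Euc N → ℝ, ContDiff ℝ 1 φ → HasCompactSupport φ → tsupport φ ⊆ Ω →
    (∫ x in Ω, H (gradient u x) ^ (p - 1) * ⟪gradient H (gradient u x), gradient φ x⟫)
      = ∫ x in Ω, φ x

/-- Solution of the exterior problem: `Δ_p^H u = 0` weakly in `ℝ^N ∖ cl Ω`, `u = 1` on `∂Ω`,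
`u → 0` at infinity. -/
structure IsExteriorSol (H : Euc N → ℝ) (p : ℝ) (Ω : Set (Euc N)) (u : Euc N → ℝ) : Prop where
  contOn : ContinuousOn u Ωᶜ
  diff : ∀ x ∈ (closure Ω)ᶜ, DifferentiableAt ℝ u x
  bdry : ∀ x ∈ frontier Ω, u x = 1
  decay : Tendsto u (cocompact (Euc N)) (𝓝 0)
  weak : ∀ φ : Euc N → ℝ, ContDiff ℝ 1 φ → HasCompactSupport φ → tsupport φ ⊆ (closure Ω)ᶜ →
    (∫ x in (closure Ω)ᶜ,
      H (gradient u x) ^ (p - 1) * ⟪gradient H (gradient u x), gradient φ x⟫) = 0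

/-- The inward unit normal field associated to a defining function `f` (with `Ω = {f < 0}`). -/
def inwardField (f : Euc N → ℝ) (x : Euc N) : Euc N := -(‖gradient f x‖)⁻¹ • gradient f x

/-- `ν` is the inward unit normal of `Ω` and `M` its anisotropic mean curvature
`M = -div(∇_ξ H(ν))`, computed via a `C²` defining function. -/
def IsNormalCurv (H : Euc N → ℝ) (Ω : Set (Euc N)) (ν : Euc N → Euc N) (M : Euc N → ℝ) : Prop :=
  ∃ f : Euc N → ℝ, ContDiff ℝ 2 f ∧ Ω = {x | f x < 0} ∧ frontier Ω = {x | f x = 0} ∧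
    (∀ x ∈ frontier Ω, gradient f x ≠ 0) ∧
    (∀ x ∈ frontier Ω, ν x = inwardField f x) ∧
    (∀ x ∈ frontier Ω, M x = - divVF (fun y => gradient H (inwardField f y)) x)

/-- `ν` is the inward unit normal field of `Ω`, computed via a `C²` defining function. -/
def IsInwardNormal (Ω : Set (Euc N)) (ν : Euc N → Euc N) : Prop :=
  ∃ f : Euc N → ℝ, ContDiff ℝ 2 f ∧ Ω = {x | f x < 0} ∧ frontier Ω = {x | f x = 0} ∧
    (∀ x ∈ frontier Ω, gradient f x ≠ 0) ∧
    ∀ x ∈ frontier Ω, ν x = inwardField f x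

/-- Second elementary symmetric function of a matrix. -/
def S2 (A : Matrix (Fin N) (Fin N) ℝ) : ℝ := ((Matrix.trace A) ^ 2 - Matrix.trace (A * A)) / 2

/-- `S²_{ij}(A) = -a_{ji} + δ_{ij} Tr A`. -/
def S2ij (A : Matrix (Fin N) (Fin N) ℝ) (i j : Fin N) : ℝ :=
  -A j i + (if i = j then Matrix.trace A else 0)

/-- The matrix `W = ∇²_ξ V(Dv) D²v`. -/
def Wmat (H : Euc N → ℝ) (p : ℝ) (v : Euc N → ℝ) (x : Euc N) : Matrix (Fin N) (Fin N) ℝ :=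
  hessM (Vfun H p) (gradient v x) * hessM v x

/-- `G` is the weak (distributional) Jacobian matrix of the vector field `Z` on `Ω`, with both
`Z` and `G` square-integrable (i.e. `Z ∈ W^{1,2}(Ω)` with Jacobian `G`). -/
def IsWeakJacobianOn (Z : Euc N → Euc N) (G : Euc N → Matrix (Fin N) (Fin N) ℝ)
    (Ω : Set (Euc N)) : Prop :=
  IntegrableOn (fun x => ∑ i, (Z x i) ^ 2) Ω ∧
  IntegrableOn (fun x => ∑ i, ∑ j, (G x i j) ^ 2) Ω ∧
  ∀ (i j : Fin N) (φ : Euc N → ℝ), ContDiff ℝ 1 φ → HasCompactSupport φ → tsupport φ ⊆ Ω →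
    (∫ x in Ω, Z x i * pd j φ x) = - ∫ x in Ω, G x i j * φ x

/-- The vector field `Z` belongs to `W^{1,2}(Ω)`. -/
def MemW12 (Z : Euc N → Euc N) (Ω : Set (Euc N)) : Prop := ∃ G, IsWeakJacobianOn Z G Ω


/-- The anisotropic `p`-capacity of `Ω`. -/
def pCapacity (H : Euc N → ℝ) (p : ℝ) (Ω : Set (Euc N)) : ℝ :=
  sInf {r : ℝ | ∃ φ : Euc N → ℝ, ContDiff ℝ (⊤ : ℕ∞) φ ∧ HasCompactSupport φ ∧
    (∀ x ∈ Ω, 1 ≤ φ x) ∧ r = (1 / p) * ∫ x, H (gradient φ x) ^ p}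

/-- The `(N-1)`-dimensional Hausdorff (surface) measure on `ℝ^N`. -/
def surf (N : ℕ) : Measure (Euc N) := Measure.hausdorffMeasure ((N : ℝ) - 1)

end

noncomputable section
open MeasureTheory Filter Set
open scoped Topology RealInnerProductSpace NNReal

/-- The Jacobian matrix of a tuple of functions. -/
def jacM (a : Fin N → Euc N → ℝ) (x : Euc N) : Matrix (Fin N) (Fin N) ℝ :=
  Matrix.of fun i j => pd j (a i) x

lemma gradient_apply_eq_pd (f : Euc N → ℝ) (x : Euc N) (i : Fin N) :
    gradient f x i = pd i f x := by
  have h : ⟪gradient f x, EuclideanSpace.single i (1 : ℝ)⟫ = pd i f x := by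
    simp [gradient, pd]
  rw [← h, EuclideanSpace.inner_single_right]
  simp

lemma Filter.EventuallyEq.pd_eq {f g : Euc N → ℝ} {x : Euc N} (h : f =ᶠ[𝓝 x] g) (i : Fin N) :
    pd i f x = pd i g x := by
  rw [pd, pd, h.fderiv_eq]

lemma pd_mul {f g : Euc N → ℝ} {x : Euc N} (hf : DifferentiableAt ℝ f x)
    (hg : DifferentiableAt ℝ g x) (i : Fin N) :
    pd i (fun y => f y * g y) x = f x * pd i g x + pd i f x * g x := by
  simp only [pd]
  rw [fderiv_fun_mul hf hg]
  simp [mul_comm]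

lemma pd_add {f g : Euc N → ℝ} {x : Euc N} (hf : DifferentiableAt ℝ f x)
    (hg : DifferentiableAt ℝ g x) (i : Fin N) :
    pd i (fun y => f y + g y) x = pd i f x + pd i g x := by
  simp only [pd]
  rw [fderiv_fun_add hf hg]
  simp

lemma pd_neg (f : Euc N → ℝ) (x : Euc N) (i : Fin N) :
    pd i (fun y => -f y) x = -pd i f x := by
  simp only [pd]
  rw [fderiv_fun_neg]
  simp

lemma pd_sum {ι : Type*} {s : Finset ι} {f : ι → Euc N → ℝ} {x : Euc N}
    (hf : ∀ k ∈ s, DifferentiableAt ℝ (f k) x) (i : Fin N) :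
    pd i (fun y => ∑ k ∈ s, f k y) x = ∑ k ∈ s, pd i (f k) x := by
  simp only [pd]
  rw [fderiv_fun_sum hf]
  simp

lemma pd_rpow_const {f : Euc N → ℝ} {x : Euc N} (hf : DifferentiableAt ℝ f x) (hx : f x ≠ 0)
    (γ : ℝ) (i : Fin N) :
    pd i (fun y => f y ^ γ) x = γ * f x ^ (γ - 1) * pd i f x := by
  simp only [pd]
  rw [(hf.hasFDerivAt.rpow_const (Or.inl hx)).fderiv]
  simp

lemma ContDiffAt.pd {m n : WithTop ℕ∞} {f : Euc N → ℝ} {x : Euc N} (hf : ContDiffAt ℝ n f x)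
    (hmn : m + 1 ≤ n) (i : Fin N) : ContDiffAt ℝ m (pd i f) x :=
  (hf.fderiv_right hmn).clm_apply contDiffAt_const

lemma pd_comm {f : Euc N → ℝ} {x : Euc N} (hf : ContDiffAt ℝ 2 f x) (i j : Fin N) :
    pd i (pd j f) x = pd j (pd i f) x := by
  have hd : DifferentiableAt ℝ (fderiv ℝ f) x :=
    (hf.fderiv_right (m := 1) (by norm_num)).differentiableAt (by norm_num)
  have h (k l : Fin N) : pd k (pd l f) x =
      fderiv ℝ (fderiv ℝ f) x (EuclideanSpace.single k 1) (EuclideanSpace.single l 1) := by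
    change fderiv ℝ (fun y => fderiv ℝ f y (EuclideanSpace.single l 1)) x _ = _
    rw [fderiv_clm_apply hd (differentiableAt_const _)]
    simp
  rw [h, h]
  exact (hf.isSymmSndFDerivAt (by simp)) _ _

lemma contDiffAt_gradient {m n : WithTop ℕ∞} {f : Euc N → ℝ} {x : Euc N}
    (hf : ContDiffAt ℝ n f x) (hmn : m + 1 ≤ n) : ContDiffAt ℝ m (gradient f) x := by
  rw [contDiffAt_euclidean]
  intro i
  simp only [gradient_apply_eq_pd]
  exact hf.pd hmn i

lemma fderiv_apply_eq_sum_pd (g : Euc N → ℝ) (ξ w : Euc N) :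
    fderiv ℝ g ξ w = ∑ k, pd k g ξ * w k := by
  have h : w = ∑ k, w k • EuclideanSpace.single k (1 : ℝ) := by
    ext i
    simp [Finset.sum_apply, Pi.single_apply]
  conv_lhs => rw [h]
  simp [pd, mul_comm]

/-- The chain rule for a function composed with a gradient. -/
lemma pd_comp_gradient {g v : Euc N → ℝ} {x : Euc N}
    (hg : DifferentiableAt ℝ g (gradient v x)) (hv : ContDiffAt ℝ 2 v x) (j : Fin N) :
    pd j (fun y => g (gradient v y)) x =
      ∑ k, pd k g (gradient v x) * pd j (pd k v) x := by
  have hd : DifferentiableAt ℝ (gradient v) x :=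
    (contDiffAt_gradient (m := 1) hv (by norm_num)).differentiableAt (by norm_num)
  change fderiv ℝ (g ∘ gradient v) x _ = _
  rw [fderiv_comp x hg hd, ContinuousLinearMap.comp_apply, fderiv_apply_eq_sum_pd]
  refine Finset.sum_congr rfl fun k _ => ?_
  congr 1
  have h := ((EuclideanSpace.proj (𝕜 := ℝ) k).hasFDerivAt.comp x hd.hasFDerivAt).fderiv
  have h' : (⇑(EuclideanSpace.proj (𝕜 := ℝ) k) ∘ gradient v) = pd k v := by
    ext y
    simp [gradient_apply_eq_pd]
  rw [h'] at h
  rw [pd, h]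
  simp

lemma hessM_mul_hessM_eq_jacM {V v : Euc N → ℝ} {x : Euc N}
    (hV : ContDiffAt ℝ 2 V (gradient v x)) (hv : ContDiffAt ℝ 2 v x) :
    hessM V (gradient v x) * hessM v x = jacM (fun i y => pd i V (gradient v y)) x := by
  ext i j
  rw [jacM, Matrix.of_apply, pd_comp_gradient
    ((hV.pd (m := 1) (by norm_num) i).differentiableAt (by norm_num)) hv, Matrix.mul_apply]
  refine Finset.sum_congr rfl fun k _ => ?_
  simp only [hessM, Matrix.of_apply]
  rw [pd_comm hV, pd_comm hv]

lemma sum_S2ij_mul (A : Matrix (Fin N) (Fin N) ℝ) (w : Fin N → ℝ) (j : Fin N) :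
    ∑ i, S2ij A i j * w i = -∑ i, A j i * w i + A.trace * w j := by
  simp [S2ij, add_mul, Finset.sum_add_distrib]

/-- The field `S²_{ij}(Da) a_i` has divergence `2 S₂(Da)`. -/
lemma sum_pd_S2ij_jacM {a : Fin N → Euc N → ℝ} {x : Euc N}
    (ha : ∀ i, ContDiffAt ℝ 2 (a i) x) :
    ∑ j, pd j (fun y => ∑ i, S2ij (jacM a y) i j * a i y) x = 2 * S2 (jacM a x) := by
  have hd (i : Fin N) : DifferentiableAt ℝ (a i) x := (ha i).differentiableAt (by norm_num)
  have hdd (i j : Fin N) : DifferentiableAt ℝ (pd i (a j)) x :=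
    ((ha j).pd (m := 1) (by norm_num) i).differentiableAt (by norm_num)
  have key (j : Fin N) : pd j (fun y => ∑ i, S2ij (jacM a y) i j * a i y) x =
      -∑ i, (pd i (a j) x * pd j (a i) x + pd i (pd j (a j)) x * a i x)
        + ((∑ k, pd k (a k) x) * pd j (a j) x + (∑ k, pd j (pd k (a k)) x) * a j x) := by
    simp only [sum_S2ij_mul]
    simp only [jacM, Matrix.trace, Matrix.diag_apply, Matrix.of_apply]
    rw [pd_add (by fun_prop) (by fun_prop), pd_neg, pd_sum (by fun_prop),
      pd_mul (by fun_prop) (hd j), pd_sum (by fun_prop)]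
    congr 2
    refine Finset.sum_congr rfl fun i _ => ?_
    rw [pd_mul (hdd i j) (hd i), pd_comm (ha j)]
  rw [Finset.sum_congr rfl fun j _ => key j]
  simp only [S2, jacM, Matrix.trace, Matrix.diag_apply, Matrix.mul_apply, Matrix.of_apply,
    Finset.sum_add_distrib, Finset.sum_neg_distrib, ← Finset.mul_sum]
  have hswap : ∑ j, ∑ i, pd i (pd j (a j)) x * a i x =
      ∑ j, (∑ k, pd j (pd k (a k)) x) * a j x := by
    rw [Finset.sum_comm]
    simp only [Finset.sum_mul]
  rw [hswap]
  ring

/-- pointwise differential identity for S₂, general V. -/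
theorem S2_pointwise_identity_general
    {N : ℕ} {U : Set (Euc N)} (hU : IsOpen U)
    {v : Euc N → ℝ} (hv : ContDiffOn ℝ 3 v U) (hvpos : ∀ x ∈ U, 0 < v x)
    {V : Euc N → ℝ} (hV : ContDiff ℝ 3 V) (hVnn : ∀ ξ, 0 ≤ V ξ)
    (hcont : ContinuousOn
      (fun x => V (gradient v x) * divVF (fun y => gradient V (gradient v y)) x) U)
    (hzero : ∀ x ∈ U, gradient v x = 0 →
      V (gradient v x) * divVF (fun y => gradient V (gradient v y)) x = 0)
    (γ : ℝ) (x : Euc N) (hx : x ∈ U) :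
    2 * v x ^ γ * S2 (hessM V (gradient v x) * hessM v x) =
      divVF (fun y => toEuc (fun j =>
        v y ^ γ * ∑ i, S2ij (hessM V (gradient v y) * hessM v y) i j
          * gradient V (gradient v y) i)) x
      - γ * v x ^ (γ - 1) * ∑ j, ∑ i,
          S2ij (hessM V (gradient v x) * hessM v x) i j
            * gradient V (gradient v x) i * pd j v x := by
  have hvat {y : Euc N} (hy : y ∈ U) : ContDiffAt ℝ 3 v y := hv.contDiffAt (hU.mem_nhds hy)
  have hW {y : Euc N} (hy : y ∈ U) : hessM V (gradient v y) * hessM v y =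
      jacM (fun i z => pd i V (gradient v z)) y :=
    hessM_mul_hessM_eq_jacM (hV.contDiffAt.of_le (by norm_num)) ((hvat hy).of_le (by norm_num))
  set a : Fin N → Euc N → ℝ := fun i z => pd i V (gradient v z)
  have ha (i : Fin N) : ContDiffAt ℝ 2 (a i) x :=
    ContDiffAt.comp x (hV.contDiffAt.pd (by norm_num) i)
      (contDiffAt_gradient (hvat hx) (by norm_num))
  have hd (i : Fin N) : DifferentiableAt ℝ (a i) x := (ha i).differentiableAt (by norm_num)
  have hdd (i j : Fin N) : DifferentiableAt ℝ (pd i (a j)) x :=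
    ((ha j).pd (m := 1) (by norm_num) i).differentiableAt (by norm_num)
  have hvd : DifferentiableAt ℝ v x := (hvat hx).differentiableAt (by norm_num)
  have hdiv (j : Fin N) : pd j (fun y => toEuc (fun j =>
        v y ^ γ * ∑ i, S2ij (hessM V (gradient v y) * hessM v y) i j
          * gradient V (gradient v y) i) j) x =
      v x ^ γ * pd j (fun y => ∑ i, S2ij (jacM a y) i j * a i y) x
        + γ * v x ^ (γ - 1) * pd j v x * ∑ i, S2ij (jacM a x) i j * a i x := by
    have hev : (fun y => toEuc (fun j =>
        v y ^ γ * ∑ i, S2ij (hessM V (gradient v y) * hessM v y) i j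
          * gradient V (gradient v y) i) j) =ᶠ[𝓝 x]
        fun y => v y ^ γ * ∑ i, S2ij (jacM a y) i j * a i y := by
      filter_upwards [hU.mem_nhds hx] with y hy
      simp only [hW hy, gradient_apply_eq_pd V]
      rfl
    rw [hev.pd_eq, pd_mul (hvd.rpow_const (Or.inl (hvpos x hx).ne')) ?_,
      pd_rpow_const hvd (hvpos x hx).ne']
    simp only [sum_S2ij_mul, jacM, Matrix.trace, Matrix.diag_apply, Matrix.of_apply]
    fun_prop
  have hsum : ∑ j, γ * v x ^ (γ - 1) * pd j v x * ∑ i, S2ij (jacM a x) i j * a i x =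
      γ * v x ^ (γ - 1) * ∑ j, ∑ i, S2ij (jacM a x) i j * a i x * pd j v x := by
    simp only [Finset.mul_sum]
    exact Finset.sum_congr rfl fun j _ => Finset.sum_congr rfl fun i _ => by ring
  rw [divVF, Finset.sum_congr rfl fun j _ => hdiv j, Finset.sum_add_distrib, ← Finset.mul_sum,
    sum_pd_S2ij_jacM ha, hsum, hW hx]
  simp only [gradient_apply_eq_pd V]
  change _ = _ - γ * v x ^ (γ - 1) * ∑ j, ∑ i, S2ij (jacM a x) i j * a i x * pd j v x
  ring

end
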